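/- Let 2 ≤ k ≤ n and for each J ∈ T^1_{k−1} let D^J ∈ Λ^k satisfy e^1⌟D^J = 0. Assume that Σ_{J∈T^1_{k−1}} ⟨D^J; a∧b⟩⟨a∧b; e^1∧e^J⟩ = 0 for all a ∈ Λ^1 and b ∈ Λ^{k−1}. Then for all I, R ∈ T^1_{k−1} and J, S ∈ T_k satisfying I∩J = ∅, R∩S = ∅ and I∪J = R∪S (as sets), one has sgn(I,J)⟨D^I; e^J⟩ = (−1)^k sgn(R,S)⟨D^R; e^S⟩. -/

import Mathlib

/-! Basic setup: `Λᵏ(ℝⁿ)` in coordinates with respect to the standard basis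
`e^I`, `I` a strictly increasing multi-index (modeled as a `k`-element subset of
`Fin n`), together with the exterior product, interior product, inner product,
Hodge star, and the various notions of one-directional convexity/affinity. -/

/-- Increasing multi-indices of length `k` in `{1,…,n}`: `k`-element subsets of `Fin n`.
`Idx n k` plays the role of `T_k`. -/
abbrev Idx (n k : ℕ) := {s : Finset (Fin n) // s.card = k}

/-- `Λᵏ(ℝⁿ)`, identified with its coordinates in the standard basis `e^I`. -/
abbrev Lam (n k : ℕ) := Idx n k → ℝ

/-- The sign `sgn(R,S)` defined by `e^{[R,S]} = sgn(R,S) e^R ∧ e^S` for disjoint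
increasing multi-indices: `(-1)` to the number of inversions between `R` and `S`. -/
def msign {n : ℕ} (R S : Finset (Fin n)) : ℝ :=
  (-1 : ℝ) ^ (((R ×ˢ S).filter (fun p => p.2 < p.1)).card)

/-- The basis form `e^S` (of degree `k = S.card`; zero if `k ≠ S.card`). -/
def bform {n k : ℕ} (S : Finset (Fin n)) : Lam n k :=
  fun I => if I.1 = S then 1 else 0

/-- Exterior (wedge) product in coordinates.  When `m = k + l` this is the wedge
product `Λᵏ × Λˡ → Λ^{k+l}`; for other `m` it is `0`. -/
def wedge {n k l m : ℕ} (ω : Lam n k) (φ : Lam n l) : Lam n m :=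
  fun I => ∑ R : Idx n k, ∑ S : Idx n l,
    if R.1 ∪ S.1 = I.1 ∧ Disjoint R.1 S.1 then msign R.1 S.1 * (ω R * φ S) else 0

/-- Interior product `a ⌟ b`, characterized by `⟨a ⌟ b; c⟩ = ⟨b; a ∧ c⟩`.  When
`m = k - j` this is the interior product `Λʲ × Λᵏ → Λ^{k-j}`; for other `m` it is `0`. -/
def iprod {n j k m : ℕ} (a : Lam n j) (b : Lam n k) : Lam n m :=
  fun C => ∑ A : Idx n j, ∑ B : Idx n k,
    if A.1 ∪ C.1 = B.1 ∧ Disjoint A.1 C.1 then msign A.1 C.1 * (a A * b B) else 0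

/-- Hodge star with respect to the standard orientation; when `m = n - k` this is
`∗ : Λᵏ → Λ^{n-k}`. -/
def hstar {n k m : ℕ} (ω : Lam n k) : Lam n m :=
  fun J => ∑ I : Idx n k, if I.1 = (J.1)ᶜ then msign I.1 J.1 * ω I else 0

/-- Inner product `⟨·;·⟩` on `Λᵏ` (the basis `e^I` is orthonormal). -/
def ip {n k : ℕ} (ω α : Lam n k) : ℝ := ∑ I : Idx n k, ω I * α I

/-- `s`-fold exterior power `ω^s = ω ∧ ⋯ ∧ ω` (with `ω^0 = 1 ∈ Λ⁰`). -/
def lpow {n k : ℕ} (ω : Lam n k) : (s : ℕ) → Lam n (k * s)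
  | 0 => bform ∅
  | s + 1 => wedge ω (lpow ω s)

/-- `f : Λᵏ → ℝ` is ext. one convex. -/
def ExtOneConvex {n k : ℕ} (f : Lam n k → ℝ) : Prop :=
  ∀ (ω : Lam n k) (a : Lam n 1) (b : Lam n (k-1)),
    ConvexOn ℝ Set.univ (fun t : ℝ => f (ω + t • (wedge a b : Lam n k)))

/-- `f : Λᵏ → ℝ` is ext. one affine. -/
def ExtOneAffine {n k : ℕ} (f : Lam n k → ℝ) : Prop :=
  ExtOneConvex f ∧ ExtOneConvex (fun ω => -f ω)

/-- `f : Λᵏ → ℝ` is int. one convex. -/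
def IntOneConvex {n k : ℕ} (f : Lam n k → ℝ) : Prop :=
  ∀ (ω : Lam n k) (a : Lam n 1) (b : Lam n (k+1)),
    ConvexOn ℝ Set.univ (fun t : ℝ => f (ω + t • (iprod a b : Lam n k)))

/-- `f : Λᵏ → ℝ` is int. one affine. -/
def IntOneAffine {n k : ℕ} (f : Lam n k → ℝ) : Prop :=
  IntOneConvex f ∧ IntOneConvex (fun ω => -f ω)

/-- `f : Λ^{k+1} × Λ^{k-1} → ℝ` is ext-int. one convex. -/
def ExtIntOneConvex {n k : ℕ} (f : Lam n (k+1) → Lam n (k-1) → ℝ) : Prop :=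
  ∀ (ξ : Lam n (k+1)) (η : Lam n (k-1)) (a : Lam n 1) (b : Lam n k),
    ConvexOn ℝ Set.univ
      (fun t : ℝ => f (ξ + t • (wedge a b : Lam n (k+1))) (η + t • (iprod a b : Lam n (k-1))))

/-- `f : Λ^{k+1} × Λ^{k-1} → ℝ` is ext-int. one affine. -/
def ExtIntOneAffine {n k : ℕ} (f : Lam n (k+1) → Lam n (k-1) → ℝ) : Prop :=
  ExtIntOneConvex f ∧ ExtIntOneConvex (fun ξ η => -f ξ η)

/-- `g : Λᵏ → ℝ` is affine, i.e. a constant plus a linear functional. -/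
def AffineFn {n k : ℕ} (g : Lam n k → ℝ) : Prop :=
  ∃ (c : ℝ) (a : Lam n k), ∀ ω, g ω = c + ip a ω

section Sign

variable {n : ℕ}

theorem msign_mul_self (A B : Finset (Fin n)) : msign A B * msign A B = 1 := by
  unfold msign
  rw [← mul_pow]
  norm_num

theorem msign_union_right {A B C : Finset (Fin n)} (h : Disjoint B C) :
    msign A (B ∪ C) = msign A B * msign A C := by
  unfold msign
  rw [← pow_add, Finset.product_union, Finset.filter_union, Finset.card_union_of_disjoint]
  refine Finset.disjoint_filter_filter (Finset.disjoint_left.2 ?_)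
  intro p hB hC
  exact Finset.disjoint_left.1 h (Finset.mem_product.1 hB).2 (Finset.mem_product.1 hC).2

theorem msign_mul_msign_swap {A B : Finset (Fin n)} (h : Disjoint A B) :
    msign A B * msign B A = (-1 : ℝ) ^ (A.card * B.card) := by
  unfold msign
  rw [← pow_add, ← Finset.card_product,
    ← Finset.card_filter_add_card_filter_not (s := A ×ˢ B) (fun p => p.2 < p.1)]
  congr 2
  refine Finset.card_bij' (fun p _ => p.swap) (fun p _ => p.swap) ?_ ?_ (by simp) (by simp)
  · rintro ⟨b, a⟩ hp
    simp only [Finset.mem_filter, Finset.mem_product, Prod.swap] at hp ⊢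
    exact ⟨⟨hp.1.2, hp.1.1⟩, hp.2.not_gt⟩
  · rintro ⟨a, b⟩ hp
    simp only [Finset.mem_filter, Finset.mem_product, Prod.swap] at hp ⊢
    refine ⟨⟨hp.1.2, hp.1.1⟩, lt_of_le_of_ne (not_lt.1 hp.2) ?_⟩
    rintro rfl
    exact Finset.disjoint_left.1 h hp.1.1 hp.1.2

end Sign

section Forms

variable {n k l m : ℕ}

theorem wedge_add_left (a a' : Lam n k) (b : Lam n l) :
    (wedge (a + a') b : Lam n m) = wedge a b + wedge a' b := by
  funext K
  simp only [wedge, Pi.add_apply, ← Finset.sum_add_distrib]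
  refine Finset.sum_congr rfl fun R _ => Finset.sum_congr rfl fun S _ => ?_
  split_ifs <;> ring

theorem wedge_add_right (a : Lam n k) (b b' : Lam n l) :
    (wedge a (b + b') : Lam n m) = wedge a b + wedge a b' := by
  funext K
  simp only [wedge, Pi.add_apply, ← Finset.sum_add_distrib]
  refine Finset.sum_congr rfl fun R _ => Finset.sum_congr rfl fun S _ => ?_
  split_ifs <;> ring

theorem wedge_bform_bform (A : Idx n k) (B : Idx n l) (h : Disjoint A.1 B.1) :
    (wedge (bform A.1 : Lam n k) (bform B.1 : Lam n l) : Lam n m) =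
      msign A.1 B.1 • bform (A.1 ∪ B.1) := by
  funext K
  simp only [wedge, Pi.smul_apply, smul_eq_mul]
  rw [Finset.sum_eq_single A, Finset.sum_eq_single B]
  · simp [bform, h, eq_comm]
  · intro S _ hS
    simp [bform, Subtype.val_inj, hS]
  · simp
  · intro R _ hR
    simp [bform, Subtype.val_inj, hR]
  · simp

theorem ip_add_left (x y z : Lam n k) : ip (x + y) z = ip x z + ip y z := by
  simp [ip, add_mul, Finset.sum_add_distrib]

theorem ip_add_right (x y z : Lam n k) : ip x (y + z) = ip x y + ip x z := by
  simp [ip, mul_add, Finset.sum_add_distrib]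

theorem ip_smul_left (c : ℝ) (x y : Lam n k) : ip (c • x) y = c * ip x y := by
  simp [ip, mul_assoc, Finset.mul_sum]

theorem ip_smul_right (c : ℝ) (x y : Lam n k) : ip x (c • y) = c * ip x y := by
  simp [ip, mul_left_comm, Finset.mul_sum]

theorem ip_bform (x : Lam n k) (K : Idx n k) : ip x (bform K.1) = x K := by
  simp [ip, bform, Subtype.val_inj]

theorem ip_bform_bform (A : Finset (Fin n)) (K : Idx n k) :
    ip (bform A : Lam n k) (bform K.1) = if K.1 = A then 1 else 0 :=
  ip_bform _ K

theorem iprod_bform (A : Idx n l) (b : Lam n k) (C : Idx n m) (h : Disjoint A.1 C.1) :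
    iprod (bform A.1 : Lam n l) b C = msign A.1 C.1 * ip b (bform (A.1 ∪ C.1)) := by
  simp only [iprod]
  rw [Finset.sum_eq_single A, ip, Finset.mul_sum]
  · refine Finset.sum_congr rfl fun B _ => ?_
    simp [bform, h, eq_comm]
  · intro R _ hR
    simp [bform, Subtype.val_inj, hR]
  · simp

end Forms

section Orthogonality

variable {n k : ℕ} {e1 : Fin n} {D : Idx n (k - 1) → Lam n k}

theorem ip_bform_eq_zero_of_mem
    (hD : ∀ J : Idx n (k-1), e1 ∉ J.1 →
      (iprod (bform {e1} : Lam n 1) (D J) : Lam n (k-1)) = 0)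
    {J : Idx n (k - 1)} (hJ : e1 ∉ J.1) {K : Finset (Fin n)} (hK : K.card = k) (he : e1 ∈ K) :
    ip (D J) (bform K) = 0 := by
  have hC : (K.erase e1).card = k - 1 := by rw [Finset.card_erase_of_mem he, hK]
  have hd : Disjoint ({e1} : Finset (Fin n)) (K.erase e1) := by simp
  have h := congrFun (hD J hJ) ⟨K.erase e1, hC⟩
  rw [iprod_bform ⟨{e1}, Finset.card_singleton e1⟩ (D J) ⟨K.erase e1, hC⟩ hd] at h
  have hU : ({e1} : Finset (Fin n)) ∪ K.erase e1 = K := by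
    rw [← Finset.insert_eq, Finset.insert_erase he]
  simp only [hU, Pi.zero_apply] at h
  have hs := msign_mul_self ({e1} : Finset (Fin n)) (K.erase e1)
  exact (mul_eq_zero.1 h).resolve_left fun h0 => by simp [h0] at hs

/-- The relation obtained by testing with `a = e¹ + eⁱ` and `b = e^P + e^Q`. -/
theorem sum_ip_bform_eq_zero (hk : 1 ≤ k)
    (hD : ∀ J : Idx n (k-1), e1 ∉ J.1 →
      (iprod (bform {e1} : Lam n 1) (D J) : Lam n (k-1)) = 0)
    (hmain : ∀ (a : Lam n 1) (b : Lam n (k-1)),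
      ∑ J ∈ Finset.univ.filter (fun J : Idx n (k-1) => e1 ∉ J.1),
        ip (D J) (wedge a b) *
          ip ((wedge a b : Lam n k)) (wedge (bform {e1} : Lam n 1) (bform J.1 : Lam n (k-1))) = 0)
    (he1 : (e1 : ℕ) = 0) {i : Fin n} (hi : e1 ≠ i) (P Q : Idx n (k - 1))
    (hP : e1 ∉ P.1) (hQ : e1 ∉ Q.1) (hiP : i ∉ P.1) (hiQ : i ∉ Q.1) :
    (msign {i} P.1 * ip (D P) (bform ({i} ∪ P.1)) + msign {i} Q.1 * ip (D P) (bform ({i} ∪ Q.1))) +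
      (msign {i} P.1 * ip (D Q) (bform ({i} ∪ P.1)) +
        msign {i} Q.1 * ip (D Q) (bform ({i} ∪ Q.1))) = 0 := by
  have hs (X : Finset (Fin n)) : msign {e1} X = 1 := by
    unfold msign
    rw [Finset.filter_false_of_mem, Finset.card_empty, pow_zero]
    rintro ⟨x, y⟩ hp
    simp only [Finset.mem_product, Finset.mem_singleton] at hp
    simp [hp.1, Fin.lt_def, he1]
  have hw (j : Fin n) (X : Idx n (k - 1)) (hX : j ∉ X.1) :
      (wedge (bform {j} : Lam n 1) (bform X.1 : Lam n (k - 1)) : Lam n k) =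
        msign {j} X.1 • bform ({j} ∪ X.1) :=
    wedge_bform_bform ⟨{j}, Finset.card_singleton j⟩ X (by simpa using hX)
  have hc (X : Idx n (k - 1)) (hX : e1 ∉ X.1) : (({e1} : Finset (Fin n)) ∪ X.1).card = k := by
    rw [← Finset.insert_eq, Finset.card_insert_of_notMem hX, X.2]
    omega
  have hz (J X : Idx n (k - 1)) (hJ : e1 ∉ J.1) (hX : e1 ∉ X.1) :
      ip (D J) (bform ({e1} ∪ X.1)) = 0 :=
    ip_bform_eq_zero_of_mem hD hJ (hc X hX) (by simp)
  have hsame (J X : Idx n (k - 1)) (hJ : e1 ∉ J.1) (hX : e1 ∉ X.1) :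
      ip (bform ({e1} ∪ X.1) : Lam n k) (bform ({e1} ∪ J.1)) = if J = X then 1 else 0 := by
    rw [ip_bform_bform _ ⟨_, hc J hJ⟩]
    congr 1
    simp only [← Finset.insert_eq, eq_iff_iff]
    refine ⟨fun h => Subtype.ext ?_, fun h => by rw [h]⟩
    rw [← Finset.erase_insert hJ, h, Finset.erase_insert hX]
  have hdiff (J X : Idx n (k - 1)) (hJ : e1 ∉ J.1) (hX : e1 ∉ X.1) :
      ip (bform ({i} ∪ X.1) : Lam n k) (bform ({e1} ∪ J.1)) = 0 := by
    rw [ip_bform_bform _ ⟨_, hc J hJ⟩, if_neg]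
    intro h
    have : e1 ∈ ({i} : Finset (Fin n)) ∪ X.1 := h ▸ (by simp)
    simp [hi, hX] at this
  have h := hmain (bform {e1} + bform {i}) (bform P.1 + bform Q.1)
  have hterm : ∀ J ∈ Finset.univ.filter (fun J : Idx n (k-1) => e1 ∉ J.1),
      ip (D J) (wedge (bform {e1} + bform {i} : Lam n 1) (bform P.1 + bform Q.1 : Lam n (k-1))) *
        ip (wedge (bform {e1} + bform {i} : Lam n 1) (bform P.1 + bform Q.1 : Lam n (k-1)) : Lam n k)
          (wedge (bform {e1} : Lam n 1) (bform J.1 : Lam n (k-1))) =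
      (if J = P then msign {i} P.1 * ip (D J) (bform ({i} ∪ P.1)) +
        msign {i} Q.1 * ip (D J) (bform ({i} ∪ Q.1)) else 0) +
      (if J = Q then msign {i} P.1 * ip (D J) (bform ({i} ∪ P.1)) +
        msign {i} Q.1 * ip (D J) (bform ({i} ∪ Q.1)) else 0) := by
    intro J hJ
    have hJ' : e1 ∉ J.1 := (Finset.mem_filter.1 hJ).2
    simp only [wedge_add_left, wedge_add_right, hw _ _ hP, hw _ _ hQ, hw _ _ hiP, hw _ _ hiQ,
      hw _ _ hJ', ip_add_left, ip_add_right, ip_smul_left, ip_smul_right, hs, hz J P hJ' hP,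
      hz J Q hJ' hQ, hsame J P hJ' hP, hsame J Q hJ' hQ, hdiff J P hJ' hP, hdiff J Q hJ' hQ]
    split_ifs <;> ring
  rw [Finset.sum_congr rfl hterm, Finset.sum_add_distrib, Finset.sum_ite_eq', Finset.sum_ite_eq',
    if_pos (by simpa using hP), if_pos (by simpa using hQ)] at h
  exact h

theorem msign_mul_ip_exchange (hk : 1 ≤ k)
    (hD : ∀ J : Idx n (k-1), e1 ∉ J.1 →
      (iprod (bform {e1} : Lam n 1) (D J) : Lam n (k-1)) = 0)
    (hmain : ∀ (a : Lam n 1) (b : Lam n (k-1)),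
      ∑ J ∈ Finset.univ.filter (fun J : Idx n (k-1) => e1 ∉ J.1),
        ip (D J) (wedge a b) *
          ip ((wedge a b : Lam n k)) (wedge (bform {e1} : Lam n 1) (bform J.1 : Lam n (k-1))) = 0)
    (he1 : (e1 : ℕ) = 0) {i : Fin n} (hi : e1 ≠ i) (P Q : Idx n (k - 1))
    (hP : e1 ∉ P.1) (hQ : e1 ∉ Q.1) (hiP : i ∉ P.1) (hiQ : i ∉ Q.1) (hPQ : Disjoint P.1 Q.1) :
    msign P.1 ({i} ∪ Q.1) * ip (D P) (bform ({i} ∪ Q.1)) =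
      (-1 : ℝ) ^ k * (msign Q.1 ({i} ∪ P.1) * ip (D Q) (bform ({i} ∪ P.1))) := by
  have hdP : Disjoint ({i} : Finset (Fin n)) P.1 := by simpa using hiP
  have hdQ : Disjoint ({i} : Finset (Fin n)) Q.1 := by simpa using hiQ
  have h := sum_ip_bform_eq_zero hk hD hmain he1 hi P Q hP hQ hiP hiQ
  have hPP := sum_ip_bform_eq_zero hk hD hmain he1 hi P P hP hP hiP hiP
  have hQQ := sum_ip_bform_eq_zero hk hD hmain he1 hi Q Q hQ hQ hiQ hiQ
  have hPswap := msign_mul_msign_swap hdP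
  have hQswap := msign_mul_msign_swap hdQ
  have hswap := msign_mul_msign_swap hPQ
  have hiP1 := msign_mul_self {i} P.1
  have hiQ1 := msign_mul_self {i} Q.1
  have hQP1 := msign_mul_self Q.1 P.1
  rw [Finset.card_singleton, one_mul, P.2] at hPswap
  rw [Finset.card_singleton, one_mul, Q.2] at hQswap
  rw [P.2, Q.2] at hswap
  rw [msign_union_right hdP, msign_union_right hdQ]
  obtain ⟨q, rfl⟩ : ∃ q, k = q + 1 := ⟨k - 1, by omega⟩
  simp only [Nat.add_sub_cancel] at hPswap hQswap hswap
  have hpow : (-1 : ℝ) ^ (q * q) = (-1) ^ q := by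
    rw [pow_mul]
    rcases Nat.even_or_odd q with hq | hq
    · simp [hq.neg_one_pow]
    · simp [hq.neg_one_pow]
  rw [hpow] at hswap
  have hε : (-1 : ℝ) ^ q * (-1) ^ q = 1 := by
    rw [← mul_pow]
    norm_num
  rw [pow_succ]
  generalize (-1 : ℝ) ^ q = ε at *
  have e1' : msign P.1 {i} = ε * msign {i} P.1 := by
    linear_combination msign {i} P.1 * hPswap - msign P.1 {i} * hiP1
  have e2' : msign Q.1 {i} = ε * msign {i} Q.1 := by
    linear_combination msign {i} Q.1 * hQswap - msign Q.1 {i} * hiQ1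
  have e3' : msign P.1 Q.1 = ε * msign Q.1 P.1 := by
    linear_combination msign Q.1 P.1 * hswap - msign P.1 Q.1 * hQP1
  rw [e1', e2', e3']
  have hrel : msign {i} Q.1 * ip (D P) (bform ({i} ∪ Q.1)) =
      -(msign {i} P.1 * ip (D Q) (bform ({i} ∪ P.1))) := by
    linear_combination h - hPP / 4 - hQQ / 4
  generalize ip (D P) (bform ({i} ∪ Q.1)) = x at *
  generalize ip (D Q) (bform ({i} ∪ P.1)) = y at *
  have hx : x = -(msign {i} Q.1 * msign {i} P.1 * y) := by
    linear_combination msign {i} Q.1 * hrel - x * hiQ1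
  rw [hx]
  linear_combination (-msign Q.1 P.1 * msign {i} Q.1 * y * ε * ε) * hiP1

end Orthogonality

/-- A function on the `p`-subsets of a `(2p+1)`-set that takes values in a fixed ratio `c` on
disjoint pairs is constant. -/
theorem eq_of_forall_disjoint_eq_mul {α : Type*} [DecidableEq α] {p : ℕ} {U : Finset α}
    (hU : U.card = 2 * p + 1) {c : ℝ} (f : {s : Finset α // s.card = p} → ℝ)
    (hf : ∀ P Q : {s : Finset α // s.card = p}, P.1 ⊆ U → Q.1 ⊆ U → Disjoint P.1 Q.1 →
      f P = c * f Q)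
    (P Q : {s : Finset α // s.card = p}) (hP : P.1 ⊆ U) (hQ : Q.1 ⊆ U) : f P = f Q := by
  induction hm : (P.1 \ Q.1).card generalizing P with
  | zero =>
    have hPQ : P.1 ⊆ Q.1 := Finset.sdiff_eq_empty_iff_subset.1 (Finset.card_eq_zero.1 hm)
    rw [Subtype.ext (Finset.eq_of_subset_of_card_le hPQ (by rw [P.2, Q.2]))]
  | succ m ih =>
    have hcard : (Q.1 \ P.1).card = (P.1 \ Q.1).card :=
      Finset.card_sdiff_comm (by rw [P.2, Q.2])
    obtain ⟨x, hx⟩ : (P.1 \ Q.1).Nonempty := Finset.card_pos.1 (by omega)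
    obtain ⟨y, hy⟩ : (Q.1 \ P.1).Nonempty := Finset.card_pos.1 (by omega)
    rw [Finset.mem_sdiff] at hx hy
    have hyP : y ∉ P.1.erase x := fun h => hy.2 (Finset.mem_of_mem_erase h)
    have hp : 0 < p := P.2 ▸ Finset.card_pos.2 ⟨x, hx.1⟩
    let P' : {s : Finset α // s.card = p} := ⟨insert y (P.1.erase x), by
      rw [Finset.card_insert_of_notMem hyP, Finset.card_erase_of_mem hx.1, P.2]
      omega⟩
    have hP' : P'.1 ⊆ U :=
      Finset.insert_subset (hQ hy.1) ((Finset.erase_subset _ _).trans hP)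
    have hins : insert y P.1 ⊆ U := Finset.insert_subset (hQ hy.1) hP
    obtain ⟨T, hTU, hT⟩ : ∃ T ⊆ U \ insert y P.1, T.card = p := by
      apply Finset.exists_subset_card_eq
      rw [Finset.card_sdiff_of_subset hins, Finset.card_insert_of_notMem hy.2, P.2]
      omega
    have hdisj : Disjoint T (insert y P.1) := (Finset.subset_sdiff.1 hTU).2
    have hsub : P'.1 ⊆ insert y P.1 := Finset.insert_subset_insert _ (Finset.erase_subset _ _)
    have h1 := hf P ⟨T, hT⟩ hP (Finset.subset_sdiff.1 hTU).1
      (hdisj.mono_right (Finset.subset_insert _ _)).symm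
    have h2 := hf P' ⟨T, hT⟩ hP' (Finset.subset_sdiff.1 hTU).1 (hdisj.mono_right hsub).symm
    rw [h1, ← h2]
    refine ih P' hP' ?_
    have hdiff : P'.1 \ Q.1 = (P.1 \ Q.1).erase x := by
      rw [Finset.insert_sdiff_of_mem _ hy.1, Finset.erase_sdiff_comm]
    rw [hdiff, Finset.card_erase_of_mem (Finset.mem_sdiff.2 hx), hm, Nat.add_sub_cancel]

/-- **Lemma (orthogonality relations).** Let `2 ≤ k ≤ n` and for each `J ∈ T¹_{k-1}` let
`D^J ∈ Λᵏ` satisfy `e^1 ⌟ D^J = 0`.  If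
`∑_{J ∈ T¹_{k-1}} ⟨D^J; a∧b⟩⟨a∧b; e^1∧e^J⟩ = 0` for all `a ∈ Λ¹`, `b ∈ Λ^{k-1}`,
then for all `I, R ∈ T¹_{k-1}` and `J, S ∈ T_k` with `I ∩ J = R ∩ S = ∅` and
`I ∪ J = R ∪ S` one has `sgn(I,J)⟨D^I;e^J⟩ = (-1)^k sgn(R,S)⟨D^R;e^S⟩`. -/
theorem stmt12 {n k : ℕ} (hk : 2 ≤ k) (hkn : k ≤ n)
    (e1 : Fin n) (he1 : (e1 : ℕ) = 0)
    (D : Idx n (k-1) → Lam n k)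
    (hD : ∀ J : Idx n (k-1), e1 ∉ J.1 →
      (iprod (bform {e1} : Lam n 1) (D J) : Lam n (k-1)) = 0)
    (hmain : ∀ (a : Lam n 1) (b : Lam n (k-1)),
      ∑ J ∈ Finset.univ.filter (fun J : Idx n (k-1) => e1 ∉ J.1),
        ip (D J) (wedge a b) *
          ip ((wedge a b : Lam n k)) (wedge (bform {e1} : Lam n 1) (bform J.1 : Lam n (k-1))) = 0) :
    ∀ (I R : Idx n (k-1)) (J S : Idx n k),
      e1 ∉ I.1 → e1 ∉ R.1 → Disjoint I.1 J.1 → Disjoint R.1 S.1 → I.1 ∪ J.1 = R.1 ∪ S.1 →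
      msign I.1 J.1 * ip (D I) (bform J.1) =
        (-1 : ℝ) ^ k * (msign R.1 S.1 * ip (D R) (bform S.1)) := by
  intro I R J S hI hR hIJ hRS hU
  by_cases heU : e1 ∈ I.1 ∪ J.1
  · have heJ : e1 ∈ J.1 := (Finset.mem_union.1 heU).resolve_left hI
    have heS : e1 ∈ S.1 := (Finset.mem_union.1 (hU ▸ heU)).resolve_left hR
    rw [ip_bform_eq_zero_of_mem hD hI J.2 heJ, ip_bform_eq_zero_of_mem hD hR S.2 heS]
    simp
  set U := I.1 ∪ J.1 with hUdef
  have hUcard : U.card = 2 * (k - 1) + 1 := by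
    rw [hUdef, Finset.card_union_of_disjoint hIJ, I.2, J.2]
    omega
  let f : Idx n (k - 1) → ℝ := fun P => msign P.1 (U \ P.1) * ip (D P) (bform (U \ P.1))
  have hf : ∀ P Q : Idx n (k - 1), P.1 ⊆ U → Q.1 ⊆ U → Disjoint P.1 Q.1 →
      f P = (-1 : ℝ) ^ k * f Q := by
    intro P Q hP hQ hPQ
    obtain ⟨i, hi⟩ : ∃ i, U \ (P.1 ∪ Q.1) = {i} := by
      rw [← Finset.card_eq_one, Finset.card_sdiff_of_subset (Finset.union_subset hP hQ),
        Finset.card_union_of_disjoint hPQ, P.2, Q.2]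
      omega
    have hmem : i ∈ U \ (P.1 ∪ Q.1) := hi ▸ Finset.mem_singleton_self i
    rw [Finset.mem_sdiff, Finset.notMem_union] at hmem
    have hUP : U \ P.1 = {i} ∪ Q.1 := by
      rw [← hi]
      ext x
      have h1 := @hQ x
      have h2 : x ∈ P.1 → x ∉ Q.1 := fun h => Finset.disjoint_left.1 hPQ h
      simp only [Finset.mem_sdiff, Finset.mem_union]
      tauto
    have hUQ : U \ Q.1 = {i} ∪ P.1 := by
      rw [← hi]
      ext x
      have h1 := @hP x
      have h2 : x ∈ P.1 → x ∉ Q.1 := fun h => Finset.disjoint_left.1 hPQ h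
      simp only [Finset.mem_sdiff, Finset.mem_union]
      tauto
    simp only [f, hUP, hUQ]
    exact msign_mul_ip_exchange (by omega) hD hmain he1 (fun h => heU (h ▸ hmem.1)) P Q
      (fun h => heU (hP h)) (fun h => heU (hQ h)) hmem.2.1 hmem.2.2 hPQ
  have hIU : I.1 ⊆ U := Finset.subset_union_left
  have hRU : R.1 ⊆ U := hU ▸ Finset.subset_union_left
  have hJ : U \ I.1 = J.1 := by
    rw [hUdef, Finset.union_sdiff_cancel_left hIJ]
  have hS : U \ R.1 = S.1 := by
    rw [hU, Finset.union_sdiff_cancel_left hRS]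
  obtain ⟨T, hTJ, hT⟩ : ∃ T ⊆ J.1, T.card = k - 1 :=
    Finset.exists_subset_card_eq (by rw [J.2]; omega)
  have hTU : T ⊆ U := hTJ.trans Finset.subset_union_right
  have h1 := hf I ⟨T, hT⟩ hIU hTU (hIJ.mono_right hTJ)
  rw [eq_of_forall_disjoint_eq_mul hUcard f hf ⟨T, hT⟩ R hTU hRU] at h1
  simpa only [f, hJ, hS] using h1
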